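/- For every non-negative integer ℓ, the polynomial P_ℓ satisfies the functional equation P_ℓ(𝟏 − x) = (−1)^{nℓ+r} · P_ℓ(x), where 𝟏 := (1,1,…,1) ∈ ℝ^r. -/

import Mathlib

open MeasureTheory Complex RealInnerProductSpace
open scoped Classical

noncomputable section

/-- The data of a reduced crystallographic root system `Φ` spanning a real inner
product space `E`, together with a choice of positive system `Φ⁺`, an ordering
of the simple roots, and the corresponding fundamental dominant weights. -/
structure RootSystemData (r : ℕ) (E : Type*) [NormedAddCommGroup E] [InnerProductSpace ℝ E] where
  /-- the set of roots -/
  roots : Finset E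
  /-- the set of positive roots -/
  pos : Finset E
  /-- the (ordered) simple roots of the positive system -/
  simple : Fin r → E
  /-- the fundamental dominant weights -/
  weight : Fin r → E
  ne_zero : ∀ α ∈ roots, α ≠ (0 : E)
  span_eq : Submodule.span ℝ (roots : Set E) = ⊤
  reduced : ∀ α ∈ roots, ∀ c : ℝ, c • α ∈ roots → c = 1 ∨ c = -1
  crystallographic : ∀ α ∈ roots, ∀ β ∈ roots, ∃ z : ℤ, 2 * ⟪β, α⟫ / ⟪α, α⟫ = (z : ℝ)
  reflection_mem : ∀ α ∈ roots, ∀ β ∈ roots, β - (2 * ⟪β, α⟫ / ⟪α, α⟫) • α ∈ roots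
  pos_subset : pos ⊆ roots
  mem_pos_or : ∀ α ∈ roots, α ∈ pos ∨ -α ∈ pos
  not_both : ∀ α ∈ pos, -α ∉ pos
  simple_mem_pos : ∀ i, simple i ∈ pos
  simple_inj : Function.Injective simple
  simple_base : ∀ α ∈ pos, ∃ c : Fin r → ℕ, α = ∑ i, (c i : ℝ) • simple i
  weight_dual : ∀ i j, ⟪weight i, (2 / ⟪simple j, simple j⟫) • simple j⟫ = (if i = j then (1:ℝ) else 0)

variable {r : ℕ} {E : Type*} [NormedAddCommGroup E] [InnerProductSpace ℝ E]

/-- The pairing `(λ_i, α^∨)` of the `i`-th fundamental weight with the coroot of `α`. -/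
def RootSystemData.pairing (S : RootSystemData r E) (i : Fin r) (α : E) : ℝ :=
  ⟪S.weight i, (2 / ⟪α, α⟫) • α⟫

/-- The zeta series `ζ_Φ(s,x)` attached to the root system data. -/
def zetaRS (S : RootSystemData r E) (s : ℂ) (x : Fin r → ℝ) : ℂ :=
  ∑' m : Fin r → ℕ, ∏ α ∈ S.pos,
    (((∑ i, ((m i : ℝ) + x i) * S.pairing i α : ℝ)) : ℂ) ^ (-s)

/-- The zeta integral `𝒵_Φ(s,x)` attached to the root system data. -/
def zetaIntRS (S : RootSystemData r E) (s : ℂ) (x : Fin r → ℝ) : ℂ :=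
  ∫ t in {t : Fin r → ℝ | ∀ i, 0 < t i}, ∏ α ∈ S.pos,
    (((∑ i, (t i + x i) * S.pairing i α : ℝ)) : ℂ) ^ (-s)

/-- `v` is the value `P_ℓ(x) = ζ_Φ(-ℓ,x)` of the meromorphic continuation of the
zeta series at `s = -ℓ`. -/
def IsPValue (S : RootSystemData r E) (l : ℕ) (x : Fin r → ℝ) (v : ℂ) : Prop :=
  ∃ F : ℂ → ℂ, (∀ s : ℂ, (r : ℝ) < s.re → F s = zetaRS S s x) ∧
    MeromorphicOn F Set.univ ∧ AnalyticAt ℂ F (-(l : ℂ)) ∧ F (-(l : ℂ)) = v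

/-- `v` is the value `Q_ℓ(x) = 𝒵_Φ(-ℓ,x)` of the meromorphic continuation of the
zeta integral at `s = -ℓ`. -/
def IsQValue (S : RootSystemData r E) (l : ℕ) (x : Fin r → ℝ) (v : ℂ) : Prop :=
  ∃ F : ℂ → ℂ, (∀ s : ℂ, (r : ℝ) < s.re → F s = zetaIntRS S s x) ∧
    MeromorphicOn F Set.univ ∧ AnalyticAt ℂ F (-(l : ℂ)) ∧ F (-(l : ℂ)) = v

/-- A meromorphic function on the plane that vanishes on a right half plane vanishes at every point
of analyticity. -/
lemma MeromorphicOn.eq_zero_of_forall_re_lt {G : ℂ → ℂ} (hG : MeromorphicOn G Set.univ) {a : ℝ}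
    (h : ∀ s : ℂ, a < s.re → G s = 0) {z : ℂ} (hz : AnalyticAt ℂ G z) : G z = 0 := by
  have hfar : meromorphicOrderAt G ((a + 1 : ℝ) : ℂ) = ⊤ := by
    rw [meromorphicOrderAt_eq_top_iff]
    apply Filter.Eventually.filter_mono nhdsWithin_le_nhds
    have hopen : IsOpen {s : ℂ | a < s.re} := isOpen_lt continuous_const Complex.continuous_re
    filter_upwards [hopen.mem_nhds (show ((a + 1 : ℝ) : ℂ) ∈ {s : ℂ | a < s.re} by
      simp)] with s hs using h s hs
  have hz_top : meromorphicOrderAt G z = ⊤ := by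
    by_contra hne
    exact hG.meromorphicOrderAt_ne_top_of_isPreconnected isPreconnected_univ
      (Set.mem_univ z) (Set.mem_univ _) hne hfar
  rw [meromorphicOrderAt_eq_top_iff] at hz_top
  have hlim : Filter.Tendsto G (nhdsWithin z {z}ᶜ) (nhds (G z)) :=
    hz.continuousAt.tendsto.mono_left nhdsWithin_le_nhds
  exact tendsto_nhds_unique hlim (tendsto_const_nhds.congr' (hz_top.mono fun s hs => hs.symm))

/-- The top homogeneous part of a polynomial describes its growth along affine lines. -/
lemma MvPolynomial.tendsto_pow_mul_eval_div {σ : Type*} {p : MvPolynomial σ ℂ} {k : ℕ}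
    (hp : p.totalDegree ≤ k) (v b : σ → ℂ) :
    Filter.Tendsto (fun u : ℂ => u ^ k * eval (fun i => v i / u + b i) p)
      (nhdsWithin 0 {0}ᶜ) (nhds (eval v (homogeneousComponent k p))) := by
  let H : ℂ → ℂ := fun u => ∑ m ∈ p.support,
    coeff m p * u ^ (k - m.degree) * ∏ i ∈ m.support, (v i + u * b i) ^ m i
  have hdeg : ∀ m ∈ p.support, m.degree ≤ k := fun m hm => (le_totalDegree hm).trans hp
  have hH0 : H 0 = eval v (homogeneousComponent k p) := by
    rw [homogeneousComponent_apply, map_sum, Finset.sum_filter]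
    refine Finset.sum_congr rfl fun m hm => ?_
    split_ifs with hmk
    · simp [hmk, eval_monomial, Finsupp.prod]
    · have : k - m.degree ≠ 0 := by have := hdeg m hm; omega
      simp [this]
  have hcont : Continuous H := by fun_prop
  rw [← hH0]
  refine (hcont.tendsto 0 |>.mono_left nhdsWithin_le_nhds).congr' ?_
  filter_upwards [self_mem_nhdsWithin] with u hu
  have hu : u ≠ 0 := hu
  rw [eval_eq, Finset.mul_sum]
  refine Finset.sum_congr rfl fun m hm => ?_
  have h1 : ∀ i, v i + u * b i = u * (v i / u + b i) := fun i => by field_simp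
  simp_rw [h1, mul_pow, Finset.prod_mul_distrib, Finset.prod_pow_eq_pow_sum]
  have h2 : ∑ i ∈ m.support, m i = m.degree := rfl
  rw [h2, ← Nat.sub_add_cancel (hdeg m hm), pow_add]
  simp only [Nat.add_sub_cancel]
  ring

lemma MvPolynomial.IsHomogeneous.eval_const_mul {σ R : Type*} [CommSemiring R]
    {p : MvPolynomial σ R} {k : ℕ} (hp : p.IsHomogeneous k) (c : R) (v : σ → R) :
    eval (fun i => c * v i) p = c ^ k * eval v p := by
  rw [eval_eq, eval_eq, Finset.mul_sum]
  refine Finset.sum_congr rfl fun m hm => ?_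
  have hd : ∑ i ∈ m.support, m i = k := by
    have h1 := hp (mem_support_iff.1 hm)
    rwa [Pi.one_def, ← Finsupp.degree_eq_weight_one] at h1
  simp_rw [mul_pow, Finset.prod_mul_distrib, Finset.prod_pow_eq_pow_sum, hd]
  ring

/-- A nonzero polynomial has a nonzero top homogeneous component. -/
lemma MvPolynomial.homogeneousComponent_totalDegree_ne_zero {σ : Type*} {p : MvPolynomial σ ℂ}
    (hp : p ≠ 0) : homogeneousComponent p.totalDegree p ≠ 0 := by
  obtain ⟨m, hm, hmd⟩ := Finset.exists_mem_eq_sup p.support (support_nonempty.2 hp)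
    fun m => m.sum fun _ e => e
  have hd : m.degree = p.totalDegree := hmd.symm
  rw [ne_zero_iff]
  refine ⟨m, ?_⟩
  rw [coeff_homogeneousComponent, if_pos hd]
  exact mem_support_iff.1 hm

/-- A nonzero polynomial satisfying the distribution relation of level `2` and weight `N` in `r`
variables has total degree `N + r`. -/
lemma MvPolynomial.totalDegree_eq_of_distribution {r N : ℕ} {p : MvPolynomial (Fin r) ℂ}
    (hp : p ≠ 0)
    (h : ∀ y : Fin r → ℂ, 2 ^ N * ∑ ε : Fin r → Fin 2,
      eval (fun i => (y i + ((ε i : ℕ) : ℂ)) / 2) p = eval y p) :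
    p.totalDegree = N + r := by
  set k := p.totalDegree with hk
  obtain ⟨v, hv⟩ : ∃ v, eval v (homogeneousComponent k p) ≠ 0 := by
    by_contra! hall
    exact homogeneousComponent_totalDegree_ne_zero hp (funext fun v => by simpa using hall v)
  have hhalf : eval (fun i => v i / 2) (homogeneousComponent k p)
      = (2 ^ k)⁻¹ * eval v (homogeneousComponent k p) := by
    have := (homogeneousComponent_isHomogeneous k p).eval_const_mul 2⁻¹ v
    rw [inv_pow] at this
    rw [← this]
    congr 2
    ext i
    ring
  have hL : Filter.Tendsto (fun u : ℂ => 2 ^ N * ∑ ε : Fin r → Fin 2,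
      u ^ k * eval (fun i => v i / 2 / u + ((ε i : ℕ) : ℂ) / 2) p) (nhdsWithin 0 {0}ᶜ)
      (nhds (2 ^ N * ∑ _ε : Fin r → Fin 2,
        eval (fun i => v i / 2) (homogeneousComponent k p))) :=
    (tendsto_finsetSum _ fun ε _ => tendsto_pow_mul_eval_div hk.ge _ _).const_mul _
  have hR := tendsto_pow_mul_eval_div hk.ge v 0
  have heq := tendsto_nhds_unique hL (hR.congr fun u => by
    rw [← Finset.mul_sum, mul_left_comm]
    simp only [Pi.zero_apply, add_zero]
    rw [← h]
    simp only [add_div, div_right_comm])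
  rw [hhalf] at heq
  simp only [Finset.sum_const, Finset.card_univ, Fintype.card_pi_const, Fintype.card_fin,
    nsmul_eq_mul, Nat.cast_pow, Nat.cast_ofNat] at heq
  have h6 : (2 : ℂ) ^ (N + r) = 2 ^ k := by
    rw [pow_add]
    have h7 : (2 : ℂ) ^ k ≠ 0 := pow_ne_zero _ two_ne_zero
    field_simp at heq
    linear_combination heq
  exact (Nat.pow_right_injective (le_refl 2) (by exact_mod_cast h6)).symm

/-- A polynomial satisfying the distribution relation of level `2` and weight `N` in `r` variables
is symmetric, up to the sign `(-1) ^ (N + r)`, under `y ↦ 1 - y`. -/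
lemma MvPolynomial.eval_one_sub_of_distribution {r N : ℕ} {p : MvPolynomial (Fin r) ℂ}
    (h : ∀ y : Fin r → ℂ, 2 ^ N * ∑ ε : Fin r → Fin 2,
      eval (fun i => (y i + ((ε i : ℕ) : ℂ)) / 2) p = eval y p) (y : Fin r → ℂ) :
    eval (fun i => 1 - y i) p = (-1) ^ (N + r) * eval y p := by
  by_cases hp : p = 0
  · simp [hp]
  have hpd := totalDegree_eq_of_distribution hp h
  let q : MvPolynomial (Fin r) ℂ := bind₁ (fun i => 1 - X i) p - C ((-1) ^ (N + r)) * p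
  have hq : ∀ y, eval y q = eval (fun i => 1 - y i) p - (-1) ^ (N + r) * eval y p := fun y => by
    have : eval y (bind₁ (fun i => 1 - X i) p) = eval (fun i => 1 - y i) p := by
      simp only [← coe_aeval_eq_eval, RingHom.coe_coe, aeval_bind₁]
      simp
    simp [q, this]
  have hrefl : ∀ y : Fin r → ℂ, 2 ^ N * ∑ ε : Fin r → Fin 2,
      eval (fun i => 1 - (y i + ((ε i : ℕ) : ℂ)) / 2) p = eval (fun i => 1 - y i) p := fun y => by
    rw [← h]
    congr 1
    refine Fintype.sum_equiv (Equiv.piCongrRight fun _ => Fin.revPerm) _ _ fun ε => ?_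
    congr 2
    ext i
    have : (((Fin.rev (ε i) : Fin 2) : ℕ) : ℂ) = 1 - ((ε i : ℕ) : ℂ) := by
      generalize ε i = e
      fin_cases e <;> simp
    simp only [Equiv.piCongrRight_apply, Pi.map_apply, Fin.revPerm_apply, this]
    ring
  suffices hq0 : q = 0 by
    have := hq y
    rw [hq0, map_zero] at this
    exact (sub_eq_zero.1 this.symm)
  by_contra hq0
  have hqd : q.totalDegree = N + r := totalDegree_eq_of_distribution hq0 fun y => by
    simp only [hq, Finset.sum_sub_distrib, mul_sub, hrefl, ← Finset.mul_sum]
    rw [← h y]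
    ring
  apply homogeneousComponent_totalDegree_ne_zero hq0
  refine funext fun v => ?_
  rw [map_zero, hqd]
  have hneg := tendsto_pow_mul_eval_div hpd.le (fun i => - v i) 1
  have hpos := (tendsto_pow_mul_eval_div hpd.le v 0).const_mul ((-1 : ℂ) ^ (N + r))
  have hmain := tendsto_pow_mul_eval_div hqd.le v 0
  have hsub := tendsto_nhds_unique hmain ((hneg.sub hpos).congr fun u => by
    simp only [hq, Pi.zero_apply, Pi.one_apply, add_zero, neg_div, neg_add_eq_sub]
    ring)
  have hflip := (homogeneousComponent_isHomogeneous (N + r) p).eval_const_mul (-1) v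
  simp only [neg_one_mul] at hflip
  rw [hsub, hflip, sub_self]

/-- A product of nonnegative summable sequences in separate variables is summable. -/
lemma summable_prod_apply_fin {r : ℕ} {g : Fin r → ℕ → ℝ} (hg : ∀ i, Summable (g i))
    (hg0 : ∀ i, 0 ≤ g i) : Summable fun m : Fin r → ℕ => ∏ i, g i (m i) := by
  induction r with
  | zero => exact Summable.of_finite
  | succ r ih =>
    have ih' := ih (fun i => hg i.succ) fun i => hg0 i.succ
    have h := (hg 0).mul_of_nonneg ih' (hg0 0) fun m =>
      Finset.prod_nonneg fun i _ => hg0 i.succ (m i)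
    rw [← (Fin.consEquiv fun _ : Fin (r + 1) => ℕ).summable_iff]
    refine h.congr fun m => ?_
    simp [Fin.prod_univ_succ, Fin.consEquiv]

/-- Splitting a summable family on `ℕ ^ r` according to the parities of the indices. -/
lemma Summable.sum_tsum_parity {r : ℕ} {f : (Fin r → ℕ) → ℂ} (hf : Summable f) :
    ∑ ε : Fin r → Fin 2, ∑' m : Fin r → ℕ, f (fun i => m i * 2 + (ε i : ℕ)) = ∑' m, f m := by
  let e : (Fin r → Fin 2) × (Fin r → ℕ) ≃ (Fin r → ℕ) :=
    (Equiv.prodComm _ _).trans <|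
      (Equiv.arrowProdEquivProdArrow (Fin r) (fun _ => ℕ) fun _ => Fin 2).symm.trans
        (Equiv.piCongrRight fun _ => (Nat.divModEquiv 2).symm)
  have he : ∀ q, f (e q) = f (fun i => q.2 i * 2 + (q.1 i : ℕ)) := fun q => rfl
  have hsum : Summable fun q => f (e q) := e.summable_iff.2 hf
  rw [← e.tsum_eq f, hsum.tsum_prod, tsum_fintype]
  simp only [he]

namespace RootSystemData

lemma inner_self_pos (S : RootSystemData r E) {α : E} (hα : α ∈ S.pos) : 0 < ⟪α, α⟫ :=
  real_inner_self_pos.2 (S.ne_zero α (S.pos_subset hα))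

lemma pairing_simple (S : RootSystemData r E) (i j : Fin r) :
    S.pairing i (S.simple j) = if i = j then 1 else 0 := S.weight_dual i j

lemma inner_weight_simple (S : RootSystemData r E) (i j : Fin r) :
    ⟪S.weight i, S.simple j⟫ = if i = j then ⟪S.simple j, S.simple j⟫ / 2 else 0 := by
  have h := S.weight_dual i j
  have hpos := S.inner_self_pos (S.simple_mem_pos j)
  rw [real_inner_smul_right] at h
  split_ifs at h ⊢
  · field_simp at h ⊢
    linarith
  · exact (mul_eq_zero.1 h).resolve_left (by positivity)

lemma exists_pairing_eq (S : RootSystemData r E) {α : E} (hα : α ∈ S.pos) :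
    ∃ c : Fin r → ℕ, α = ∑ i, (c i : ℝ) • S.simple i ∧
      ∀ i, S.pairing i α = c i * ⟪S.simple i, S.simple i⟫ / ⟪α, α⟫ := by
  obtain ⟨c, hc⟩ := S.simple_base α hα
  refine ⟨c, hc, fun i => ?_⟩
  have h : ⟪S.weight i, α⟫ = c i * (⟪S.simple i, S.simple i⟫ / 2) := by
    conv_lhs => rw [hc]
    simp [inner_sum, real_inner_smul_right, inner_weight_simple]
  rw [pairing, real_inner_smul_right, h]
  ring

lemma pairing_nonneg (S : RootSystemData r E) (i : Fin r) {α : E} (hα : α ∈ S.pos) :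
    0 ≤ S.pairing i α := by
  obtain ⟨c, -, hc⟩ := S.exists_pairing_eq hα
  rw [hc]
  have h1 := S.inner_self_pos hα
  have h2 := S.inner_self_pos (S.simple_mem_pos i)
  positivity

lemma exists_pairing_pos (S : RootSystemData r E) {α : E} (hα : α ∈ S.pos) :
    ∃ i, 0 < S.pairing i α := by
  obtain ⟨c, hα', hc⟩ := S.exists_pairing_eq hα
  by_contra! hall
  refine S.ne_zero α (S.pos_subset hα) (hα'.trans (Finset.sum_eq_zero fun i _ => ?_))
  have h0 : S.pairing i α = 0 := le_antisymm (hall i) (S.pairing_nonneg i hα)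
  have h1 := S.inner_self_pos hα
  have h2 := S.inner_self_pos (S.simple_mem_pos i)
  rw [hc, div_eq_zero_iff, mul_eq_zero] at h0
  rw [(h0.resolve_right h1.ne').resolve_right h2.ne', zero_smul]

lemma sum_mul_pairing_pos (S : RootSystemData r E) {α : E} (hα : α ∈ S.pos) {y : Fin r → ℝ}
    (hy : ∀ i, 0 < y i) : 0 < ∑ i, y i * S.pairing i α := by
  obtain ⟨i, hi⟩ := S.exists_pairing_pos hα
  exact Finset.sum_pos' (fun j _ => mul_nonneg (hy j).le (S.pairing_nonneg j hα))
    ⟨i, Finset.mem_univ i, mul_pos (hy i) hi⟩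

/-- The product of the factors attached to all positive roots is bounded below by a constant
multiple of the product of the factors attached to the simple roots. -/
lemma exists_mul_prod_le (S : RootSystemData r E) {x : Fin r → ℝ} (hx : ∀ i, 0 < x i) :
    ∃ K : ℝ, 0 < K ∧ ∀ m : Fin r → ℕ,
      K * ∏ i, ((m i : ℝ) + x i) ≤ ∏ α ∈ S.pos, ∑ i, ((m i : ℝ) + x i) * S.pairing i α := by
  let T := Finset.univ.image S.simple
  have hT : T ⊆ S.pos := by
    intro α hα
    obtain ⟨i, -, rfl⟩ := Finset.mem_image.1 hα
    exact S.simple_mem_pos i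
  refine ⟨∏ α ∈ S.pos \ T, ∑ i, x i * S.pairing i α, Finset.prod_pos fun α hα =>
    S.sum_mul_pairing_pos (Finset.mem_sdiff.1 hα).1 hx, fun m => ?_⟩
  rw [← Finset.prod_sdiff hT]
  have hsimple : ∏ α ∈ T, ∑ i, ((m i : ℝ) + x i) * S.pairing i α = ∏ i, ((m i : ℝ) + x i) := by
    rw [Finset.prod_image fun i _ j _ h => S.simple_inj h]
    simp [pairing_simple]
  rw [hsimple]
  refine mul_le_mul_of_nonneg_right (Finset.prod_le_prod (fun α hα =>
    (S.sum_mul_pairing_pos (Finset.mem_sdiff.1 hα).1 hx).le) fun α hα =>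
    Finset.sum_le_sum fun i _ => mul_le_mul_of_nonneg_right (by simp)
      (S.pairing_nonneg i (Finset.mem_sdiff.1 hα).1)) (Finset.prod_nonneg fun i _ => by
        have := (hx i).le
        positivity)

/-- The zeta series converges absolutely for `1 < re s`. -/
lemma summable_zetaRS (S : RootSystemData r E) {x : Fin r → ℝ} (hx : ∀ i, 0 < x i) {s : ℂ}
    (hs : 1 < s.re) :
    Summable fun m : Fin r → ℕ => ∏ α ∈ S.pos,
      (((∑ i, ((m i : ℝ) + x i) * S.pairing i α : ℝ)) : ℂ) ^ (-s) := by
  obtain ⟨K, hK, hle⟩ := S.exists_mul_prod_le hx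
  have hy : ∀ (m : Fin r → ℕ) i, 0 < (m i : ℝ) + x i := fun m i => by
    have := hx i
    positivity
  have hsum : Summable fun m : Fin r → ℕ => ∏ i, ((m i : ℝ) + x i) ^ (-s.re) :=
    summable_prod_apply_fin (g := fun i n => ((n : ℝ) + x i) ^ (-s.re))
      (fun i => ((Real.summable_one_div_nat_add_rpow (x i) s.re).2 hs).congr fun n => by
        have : 0 < (n : ℝ) + x i := by have := hx i; positivity
        rw [abs_of_pos this, Real.rpow_neg this.le, one_div])
      fun i n => by have := hx i; positivity
  refine Summable.of_norm_bounded (hsum.mul_left (K ^ (-s.re))) fun m => ?_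
  have hpos : ∀ α ∈ S.pos, 0 < ∑ i, ((m i : ℝ) + x i) * S.pairing i α := fun α hα =>
    S.sum_mul_pairing_pos hα (hy m)
  rw [norm_prod, Finset.prod_congr rfl fun α hα => norm_cpow_eq_rpow_re_of_pos (hpos α hα) _,
    Real.finsetProd_rpow _ _ fun α hα => (hpos α hα).le,
    Real.finsetProd_rpow _ _ fun i _ => (hy m i).le,
    ← Real.mul_rpow hK.le (Finset.prod_nonneg fun i _ => (hy m i).le)]
  exact Real.rpow_le_rpow_of_nonpos (mul_pos hK (Finset.prod_pos fun i _ => hy m i)) (hle m)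
    (by simp; linarith)

/-- The distribution relation of level `2` for the zeta series. -/
lemma sum_zetaRS_half (S : RootSystemData r E) {x : Fin r → ℝ} (hx : ∀ i, 0 < x i) {s : ℂ}
    (hs : 1 < s.re) :
    ∑ ε : Fin r → Fin 2, zetaRS S s (fun i => (x i + ((ε i : ℕ) : ℝ)) / 2)
      = ((2 : ℂ) ^ s) ^ S.pos.card * zetaRS S s x := by
  let f : (Fin r → ℕ) → ℂ := fun m => ∏ α ∈ S.pos,
    (((∑ i, ((m i : ℝ) + x i) * S.pairing i α : ℝ)) : ℂ) ^ (-s)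
  have hsum : Summable f := S.summable_zetaRS hx hs
  have hterm : ∀ (m : Fin r → ℕ) (ε : Fin r → Fin 2),
      ∏ α ∈ S.pos, (((∑ i, ((m i : ℝ) + (x i + ((ε i : ℕ) : ℝ)) / 2) * S.pairing i α : ℝ)) : ℂ)
        ^ (-s) = ((2 : ℂ) ^ s) ^ S.pos.card * f (fun i => m i * 2 + (ε i : ℕ)) := by
    intro m ε
    rw [← Finset.prod_const, ← Finset.prod_mul_distrib]
    refine Finset.prod_congr rfl fun α hα => ?_
    have hpos : 0 < ∑ i, (((m i * 2 + (ε i : ℕ) : ℕ) : ℝ) + x i) * S.pairing i α :=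
      S.sum_mul_pairing_pos hα fun i => by
        have := hx i
        positivity
    have hdouble : ∑ i, (((m i * 2 + (ε i : ℕ) : ℕ) : ℝ) + x i) * S.pairing i α
        = 2 * ∑ i, ((m i : ℝ) + (x i + ((ε i : ℕ) : ℝ)) / 2) * S.pairing i α := by
      rw [Finset.mul_sum]
      refine Finset.sum_congr rfl fun i _ => ?_
      push_cast
      ring
    rw [hdouble] at hpos ⊢
    rw [Complex.ofReal_mul, Complex.mul_cpow_ofReal_nonneg zero_le_two (by linarith), ← mul_assoc,
      Complex.ofReal_ofNat, ← Complex.cpow_add _ _ two_ne_zero, add_neg_cancel, Complex.cpow_zero,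
      one_mul]
  have hzeta : zetaRS S s x = ∑' m, f m := rfl
  rw [hzeta, ← hsum.sum_tsum_parity, Finset.mul_sum]
  refine Finset.sum_congr rfl fun ε _ => ?_
  rw [← tsum_mul_left]
  exact tsum_congr fun m => hterm m ε

end RootSystemData

/-- The distribution relation of level `2` for the values of the zeta function at `-l`. -/
lemma IsPValue.sum_half {r : ℕ} (hr : 0 < r) {E : Type*} [NormedAddCommGroup E]
    [InnerProductSpace ℝ E] {S : RootSystemData r E} {l : ℕ} {P : (Fin r → ℝ) → ℂ}
    (hP : ∀ x : Fin r → ℝ, (∀ i, 0 < x i) → IsPValue S l x (P x)) {x : Fin r → ℝ}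
    (hx : ∀ i, 0 < x i) :
    2 ^ (S.pos.card * l) * ∑ ε : Fin r → Fin 2, P (fun i => (x i + ((ε i : ℕ) : ℝ)) / 2)
      = P x := by
  have hx' : ∀ (ε : Fin r → Fin 2) i, 0 < (x i + ((ε i : ℕ) : ℝ)) / 2 := fun ε i => by
    have := hx i
    positivity
  obtain ⟨F, hF, hFm, hFa, hFv⟩ := hP x hx
  choose G hG hGm hGa hGv using fun ε => hP _ (hx' ε)
  have hpow : AnalyticOnNhd ℂ (fun s : ℂ => ((2 : ℂ) ^ s) ^ S.pos.card) Set.univ := fun s _ =>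
    (analyticAt_const.cpow analyticAt_id (by simp)).pow _
  let D : ℂ → ℂ := fun s => ∑ ε, G ε s - ((2 : ℂ) ^ s) ^ S.pos.card * F s
  have hD : D (-(l : ℂ)) = 0 := by
    refine MeromorphicOn.eq_zero_of_forall_re_lt (a := r) (fun s hs => ?_) (fun s hs => ?_) ?_
    · exact (MeromorphicAt.fun_sum fun ε _ => hGm ε s hs).sub
        ((hpow s hs).meromorphicAt.mul (hFm s hs))
    · have hs1 : 1 < s.re := lt_of_le_of_lt (by exact_mod_cast hr) hs
      simp only [D]
      rw [hF s (by simpa using hs), Finset.sum_congr rfl fun ε _ => hG ε s (by simpa using hs),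
        S.sum_zetaRS_half hx hs1, sub_self]
    · exact (Finset.univ.analyticAt_fun_sum fun ε _ => hGa ε).sub ((hpow _ trivial).mul hFa)
  simp only [D, hFv, hGv, Complex.cpow_neg, Complex.cpow_natCast, sub_eq_zero] at hD
  rw [hD, mul_comm S.pos.card, pow_mul, inv_pow, ← mul_assoc,
    mul_inv_cancel₀ (pow_ne_zero _ (pow_ne_zero _ two_ne_zero)), one_mul]

/-- The functional equation `P_ℓ(𝟏 - x) = (-1)^{nℓ+r} P_ℓ(x)`. -/
theorem Pl_functional_equation {r : ℕ} (hr : 0 < r) {E : Type*} [NormedAddCommGroup E]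
    [InnerProductSpace ℝ E] (hdim : Module.finrank ℝ E = r)
    (S : RootSystemData r E) (l : ℕ)
    (P : (Fin r → ℝ) → ℂ)
    (hPpoly : ∃ p : MvPolynomial (Fin r) ℂ,
      ∀ x : Fin r → ℝ, P x = MvPolynomial.eval (fun i => (x i : ℂ)) p)
    (hPval : ∀ x : Fin r → ℝ, (∀ i, 0 < x i) → IsPValue S l x (P x)) :
    ∀ x : Fin r → ℝ,
      P (fun i => 1 - x i) = (-1 : ℂ) ^ (S.pos.card * l + r) * P x := by
  obtain ⟨p, hp⟩ := hPpoly
  have hdist : MvPolynomial.C (2 ^ (S.pos.card * l)) * ∑ ε : Fin r → Fin 2,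
      MvPolynomial.bind₁ (fun i => (MvPolynomial.X i + MvPolynomial.C ((ε i : ℕ) : ℂ))
        * MvPolynomial.C (1 / 2)) p = p := by
    refine MvPolynomial.funext_set (fun _ => Complex.ofReal '' Set.Ioi 0)
      (fun _ => (Set.Ioi_infinite 0).image Complex.ofReal_injective.injOn) fun y hy => ?_
    choose x hx hxy using fun i => hy i trivial
    obtain rfl : (fun i => (x i : ℂ)) = y := _root_.funext hxy
    rw [← hp, ← IsPValue.sum_half hr hPval hx]
    simp only [← MvPolynomial.coe_aeval_eq_eval, RingHom.coe_coe, map_mul, map_sum,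
      MvPolynomial.aeval_bind₁, hp]
    simp [div_eq_mul_inv]
  intro x
  rw [hp, hp]
  push_cast
  refine MvPolynomial.eval_one_sub_of_distribution (fun y => ?_) _
  conv_rhs => rw [← hdist]
  simp only [← MvPolynomial.coe_aeval_eq_eval, RingHom.coe_coe, map_mul, map_sum,
    MvPolynomial.aeval_bind₁]
  simp [div_eq_mul_inv]
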